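/- Let the $\mathcal P$-adic partial sums $S_N(x) = \sum_{\bar n < \tilde N} b_{\bar n} \psi^{\mathcal P}_{\bar n}(x)$ of a multiple Price series converge almost everywhere on $[0,1]^d$ to a function $f$, where $\sup_{i,j} p^j_i < \infty$. Suppose there exists a sequence $\{h_m\}$ satisfying conditions (h1)–(h3) on $[0,1]^d$ such that $\lim_{m \to \infty} \int_{\{x \in [0,1]^d : \Psi^*(x) > h_m(x)\}} h_m(x)\,dx = 0$, where $\Psi^*(x) = \sup_N |S_N(x)|$. Then for every $\bar n \in \mathbb Z_+^d$, $b_{\bar n} = \lim_{m \to \infty} \int_{[0,1]^d} \left[ f(x)\, \overline{\psi^{\mathcal P}_{\bar n}(x)} \right]_{h_m(x)} dx$. -/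

import Mathlib

open MeasureTheory Filter Topology

noncomputable section

/-- `mseq p k = ∏_{i<k} p i`, i.e. `m_k = p_1 ⋯ p_k` (Lean indexes `p` from `0`). -/
def mseq (p : ℕ → ℕ) (k : ℕ) : ℕ := ∏ i ∈ Finset.range k, p i

/-- `pdigit p x j` is the `(j+1)`-st digit `x_{j+1}` of the `P`-adic expansion
`x = ∑_t x_t/m_t`, `0 ≤ x_t ≤ p_t - 1` (for `P`-rational points this floor-based digit
extraction yields exactly the finite expansion, as chosen in the paper). -/
def pdigit (p : ℕ → ℕ) (x : ℝ) (j : ℕ) : ℕ :=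
  (⌊x * (mseq p (j + 1) : ℝ)⌋ % (p j : ℤ)).toNat

/-- `e^{2πit}`. -/
def eTwoPi (t : ℝ) : ℂ := Complex.exp (2 * (Real.pi : ℂ) * Complex.I * (t : ℂ))

/-- The Price function `ψ_k(x) = exp(2πi ∑_j α_j x_j / p_j)`, where
`k = ∑_j α_j m_{j-1}` with digits `0 ≤ α_j ≤ p_j - 1` (so `α_{j+1} = (k / m_j) mod p_{j+1}`
in Lean's `0`-based indexing; digits with index `> k` vanish, so the cut-off below is
harmless). -/
def price (p : ℕ → ℕ) (k : ℕ) (x : ℝ) : ℂ :=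
  eTwoPi (∑ j ∈ Finset.range (k + 1),
    (((k / mseq p j) % p j : ℕ) : ℝ) * (pdigit p x j : ℝ) / (p j : ℝ))

/-- The rank of the generalized Haar function `χ_n`, i.e. the unique `k` with
`m_k ≤ n < m_{k+1}` (and `0` for `n = 0`). -/
def hrank (p : ℕ → ℕ) (n : ℕ) : ℕ := Nat.findGreatest (fun k => mseq p k ≤ n) n

/-- The generalized Haar function `χ_n`: `χ_0 ≡ 1`, and for
`n = m_k + r(p_{k+1} - 1) + s - 1` with `0 ≤ r ≤ m_k - 1`, `1 ≤ s ≤ p_{k+1} - 1`,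
`χ_n(x) = √(m_k) · e^{2πi x_{k+1} s / p_{k+1}}` for `x ∈ [r/m_k, (r+1)/m_k)` and `0`
otherwise. -/
def ghaar (p : ℕ → ℕ) (n : ℕ) (x : ℝ) : ℂ :=
  if n = 0 then 1
  else
    let k := hrank p n
    let r := (n - mseq p k) / (p k - 1)
    let s := (n - mseq p k) % (p k - 1) + 1
    if (r : ℝ) / (mseq p k : ℝ) ≤ x ∧ x < ((r : ℝ) + 1) / (mseq p k : ℝ) then
      (Real.sqrt (mseq p k) : ℂ) * eTwoPi ((pdigit p x k : ℝ) * (s : ℝ) / (p k : ℝ))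
    else 0

/-- The multiple generalized Haar function `χ^𝒫_n(x) = χ¹_{n₁}(x₁) ⋯ χᵈ_{n_d}(x_d)`. -/
def ghaarD {d : ℕ} (p : Fin d → ℕ → ℕ) (n : Fin d → ℕ) (x : Fin d → ℝ) : ℂ :=
  ∏ j, ghaar (p j) (n j) (x j)

/-- The multiple Price function `ψ^𝒫_n(x) = ψ¹_{n₁}(x₁) ⋯ ψᵈ_{n_d}(x_d)`. -/
def priceD {d : ℕ} (p : Fin d → ℕ → ℕ) (n : Fin d → ℕ) (x : Fin d → ℝ) : ℂ :=
  ∏ j, price (p j) (n j) (x j)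

/-- The `𝒫`-adic partial sum `∑_{n̄ < Ñ} a_{n̄} χ^𝒫_{n̄}(x)`, `Ñ = (N,…,N)`, where
`n̄ < Ñ` means `n_j < mʲ_N` for all `j`. -/
def ghaarSum {d : ℕ} (p : Fin d → ℕ → ℕ) (a : (Fin d → ℕ) → ℂ) (N : ℕ)
    (x : Fin d → ℝ) : ℂ :=
  ∑ n ∈ Fintype.piFinset (fun j => Finset.range (mseq (p j) N)), a n * ghaarD p n x

/-- The `𝒫`-adic partial sum `∑_{n̄ < Ñ} b_{n̄} ψ^𝒫_{n̄}(x)`. -/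
def priceSum {d : ℕ} (p : Fin d → ℕ → ℕ) (b : (Fin d → ℕ) → ℂ) (N : ℕ)
    (x : Fin d → ℝ) : ℂ :=
  ∑ n ∈ Fintype.piFinset (fun j => Finset.range (mseq (p j) N)), b n * priceD p n x

/-- The `𝒫`-adic parallelepiped of rank `k` with corner index `n`. -/
def cell {d : ℕ} (p : Fin d → ℕ → ℕ) (k : ℕ) (n : Fin d → ℤ) : Set (Fin d → ℝ) :=
  Set.univ.pi fun j =>
    Set.Icc ((n j : ℝ) / (mseq (p j) k : ℝ)) (((n j : ℝ) + 1) / (mseq (p j) k : ℝ))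

/-- `Λᵈ`, the collection of all `𝒫`-adic parallelepipeds. -/
def Lambda {d : ℕ} (p : Fin d → ℕ → ℕ) : Set (Set (Fin d → ℝ)) :=
  {I | ∃ k n, I = cell p k n}

/-- `Ψ` is additive on the `𝒫`-adic parallelepipeds. -/
def IsAdditive {d : ℕ} (p : Fin d → ℕ → ℕ) (Ψ : Set (Fin d → ℝ) → ℂ) : Prop :=
  ∀ (I : Set (Fin d → ℝ)) (s : ℕ) (J : Fin s → Set (Fin d → ℝ)),
    I ∈ Lambda p → (∀ i, J i ∈ Lambda p) →
    (∀ i j, i ≠ j → Disjoint (interior (J i)) (interior (J j))) →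
    (⋃ i, J i) = I → Ψ I = ∑ i, Ψ (J i)

/-- Truncation of `f` by the function `lam`: `[f(x)]_{lam(x)}`. -/
def trunc {α : Type*} (f : α → ℂ) (lam : α → ℝ) (x : α) : ℂ :=
  if ‖f x‖ ≤ lam x then f x else 0

/-- Conditions (h1)–(h3) on the sequence of functions `h m : I₀ → ℝ`. -/
def HConds {d : ℕ} (p : Fin d → ℕ → ℕ) (I0 : Set (Fin d → ℝ))
    (h : ℕ → (Fin d → ℝ) → ℝ) : Prop :=
  (∀ x ∈ I0, (∀ m, 0 ≤ h m x) ∧ (Monotone fun m => h m x) ∧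
      Tendsto (fun m => h m x) atTop atTop) ∧
  ∃ C > (0 : ℝ), ∃ ε > (0 : ℝ), ∀ m : ℕ, ∃ (s : ℕ) (J : Fin s → Set (Fin d → ℝ)),
    (∀ i, J i ∈ Lambda p) ∧
    (∀ i j, i ≠ j → Disjoint (interior (J i)) (interior (J j))) ∧
    (⋃ i, J i) = I0 ∧
    (∀ i, ∀ x ∈ J i, ∀ y ∈ J i, h m x ≤ C * h m y) ∧
    (∀ i, ε ≤ ∫ x in J i, h m x)

/-- `‖χ^𝒫_{n̄}‖_∞ = ∏_j √(mʲ_{rank(n_j)})`, the sup-norm of the multiple generalized Haar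
function `χ^𝒫_{n̄}`. -/
def ghaarNormD {d : ℕ} (p : Fin d → ℕ → ℕ) (n : Fin d → ℕ) : ℝ :=
  ∏ j, Real.sqrt (mseq (p j) (hrank (p j) (n j)))


theorem measurableSet_of_saturated {Ω ι : Type*} [MeasurableSpace Ω] [MeasurableSpace ι]
    [DiscreteMeasurableSpace ι] {c : Ω → ι} (hc : Measurable c) {B : Set Ω}
    (hB : ∀ x y, c x = c y → x ∈ B → y ∈ B) : MeasurableSet B := by
  have : B = c ⁻¹' (c '' B) := by
    refine Set.Subset.antisymm (Set.subset_preimage_image c B) ?_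
    rintro y ⟨x, hx, hxy⟩
    exact hB x y hxy hx
  rw [this]
  exact hc (MeasurableSet.of_discrete)

theorem hasSum_setIntegral_fibers {Ω ι G : Type*} [MeasurableSpace Ω] {μ : Measure Ω}
    [Countable ι] [MeasurableSpace ι] [DiscreteMeasurableSpace ι]
    [NormedAddCommGroup G] [NormedSpace ℝ G] {c : Ω → ι} (hc : Measurable c) {B : Set Ω}
    (hB : MeasurableSet B) {u : Ω → G} (hu : IntegrableOn u B μ) :
    HasSum (fun a => ∫ x in B ∩ c ⁻¹' {a}, u x ∂μ) (∫ x in B, u x ∂μ) := by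
  have hU : (⋃ a, B ∩ c ⁻¹' {a}) = B := by
    ext x; simp
  have := hasSum_integral_iUnion (μ := μ) (f := u) (s := fun a => B ∩ c ⁻¹' {a})
    (fun a => hB.inter (hc (MeasurableSet.of_discrete)))
    (by
      intro a b hab
      refine Set.disjoint_left.2 ?_
      rintro x ⟨-, hx⟩ ⟨-, hy⟩
      exact hab (hx.symm.trans hy))
    (by rwa [hU])
  rwa [hU] at this

theorem setIntegral_eq_of_fibers {Ω ι G : Type*} [MeasurableSpace Ω] {μ : Measure Ω}
    [Countable ι] [MeasurableSpace ι] [DiscreteMeasurableSpace ι]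
    [NormedAddCommGroup G] [NormedSpace ℝ G] {c : Ω → ι} (hc : Measurable c) {B : Set Ω}
    (hB : ∀ x y, c x = c y → x ∈ B → y ∈ B) {u v : Ω → G} (hu : IntegrableOn u B μ)
    (hv : IntegrableOn v B μ) (huv : ∀ a, ∫ x in c ⁻¹' {a}, u x ∂μ = ∫ x in c ⁻¹' {a}, v x ∂μ) :
    ∫ x in B, u x ∂μ = ∫ x in B, v x ∂μ := by
  have hBm := measurableSet_of_saturated hc hB
  have s1 := hasSum_setIntegral_fibers hc hBm hu
  have s2 := hasSum_setIntegral_fibers hc hBm hv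
  have heq : (fun a => ∫ x in B ∩ c ⁻¹' {a}, u x ∂μ) =
      fun a => ∫ x in B ∩ c ⁻¹' {a}, v x ∂μ := by
    funext a
    rcases (B ∩ c ⁻¹' {a}).eq_empty_or_nonempty with hne | ⟨x, hx, rfl⟩
    · simp [hne]
    · have hQ : c ⁻¹' {c x} ⊆ B := fun y hy => hB x y hy.symm hx
      rw [Set.inter_eq_right.2 hQ, huv]
  rw [heq] at s1
  exact s1.unique s2

/-- Calderón–Zygmund type stopping estimate for a regular martingale with respect to a refining
sequence of countable partitions, given as the fibres of the maps `c N`. -/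
theorem stopping_estimate {Ω ι : Type*} [MeasurableSpace Ω] {μ : Measure Ω}
    [Countable ι] [MeasurableSpace ι] [DiscreteMeasurableSpace ι]
    {c : ℕ → Ω → ι} (hc : ∀ N, Measurable (c N))
    (href : ∀ N x y, c (N + 1) x = c (N + 1) y → c N x = c N y)
    {T : ℕ → Ω → ℂ} (hT : ∀ N x y, c N x = c N y → T N x = T N y)
    (hmart : ∀ N a, ∫ x in c N ⁻¹' {a}, T (N + 1) x ∂μ = ∫ x in c N ⁻¹' {a}, T N x ∂μ)
    {R : ℝ} (hR : 1 ≤ R)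
    (hreg : ∀ N x, μ.real (c N ⁻¹' {c N x}) ≤ R * μ.real (c (N + 1) ⁻¹' {c (N + 1) x}))
    {A E : Set Ω} (hE : MeasurableSet E) (hAfin : μ A ≠ ⊤)
    (hA : ∀ x y, c 0 x = c 0 y → x ∈ A → y ∈ A)
    (hTint : ∀ N, IntegrableOn (T N) A μ)
    (hstart : ∀ x ∈ A, R * μ.real (E ∩ c 0 ⁻¹' {c 0 x}) < μ.real (c 0 ⁻¹' {c 0 x}))
    {lam : ℝ} (hlam : 0 ≤ lam) (hbound : ∀ x ∈ A, x ∉ E → ∀ N, ‖T N x‖ ≤ lam)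
    {F : Ω → ℂ} (hF : IntegrableOn F A μ) (hFb : ∀ x ∈ A, ‖F x‖ ≤ lam)
    (hlim : ∀ᵐ x ∂μ, x ∈ A → x ∉ E → Tendsto (fun N => T N x) atTop (𝓝 (F x))) :
    ‖∫ x in A, T 0 x ∂μ - ∫ x in A, F x ∂μ‖ ≤ 4 * R * lam * μ.real (E ∩ A) := by
  have href' : ∀ k N, k ≤ N → ∀ x y, c N x = c N y → c k x = c k y := by
    intro k N hkN
    induction hkN with
    | refl => exact fun _ _ h => h
    | step _ ih => exact fun x y h => ih x y (href _ x y h)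
  have hA' : ∀ N x y, c N x = c N y → x ∈ A → y ∈ A := fun N x y h =>
    hA x y (href' 0 N (Nat.zero_le _) x y h)
  have hAm : MeasurableSet A := measurableSet_of_saturated (hc 0) hA
  have hfibA : ∀ N, ∀ x ∈ A, c N ⁻¹' {c N x} ⊆ A := fun N x hx y hy => hA' N x y hy.symm hx
  have hfin : ∀ {s : Set Ω}, s ⊆ A → μ s ≠ ⊤ := fun hs => measure_ne_top_of_subset hs hAfin
  set G : ℕ → Set Ω := fun N => {x | x ∈ A ∧ ∀ k ≤ N,
    R * μ.real (E ∩ c k ⁻¹' {c k x}) < μ.real (c k ⁻¹' {c k x})} with hG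
  have hGA : ∀ N, G N ⊆ A := fun N x hx => hx.1
  have hGsat : ∀ N x y, c N x = c N y → x ∈ G N → y ∈ G N := by
    rintro N x y h ⟨hx, hx'⟩
    refine ⟨hA' N x y h hx, fun k hk => ?_⟩
    rw [← href' k N hk x y h]
    exact hx' k hk
  have hGm : ∀ N, MeasurableSet (G N) := fun N => measurableSet_of_saturated (hc N) (hGsat N)
  have hG0 : G 0 = A := by
    refine Set.Subset.antisymm (hGA 0) fun x hx => ⟨hx, fun k hk => ?_⟩
    obtain rfl : k = 0 := by omega
    exact hstart x hx
  have hGsucc : ∀ N, G (N + 1) ⊆ G N := fun N x hx => ⟨hx.1, fun k hk => hx.2 k (by omega)⟩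
  have hpoint : ∀ N, ∀ x ∈ A, μ.real (E ∩ c N ⁻¹' {c N x}) < μ.real (c N ⁻¹' {c N x}) →
      ‖T N x‖ ≤ lam := by
    intro N x hx hlt
    obtain ⟨y, hy, hyE⟩ : ∃ y ∈ c N ⁻¹' {c N x}, y ∉ E := by
      by_contra! hcon
      rw [Set.inter_eq_right.2 hcon] at hlt
      exact lt_irrefl _ hlt
    rw [hT N x y hy.symm]
    exact hbound y (hfibA N x hx hy) hyE N
  have hTG : ∀ N, ∀ x ∈ G N, ‖T N x‖ ≤ lam := by
    intro N x hx
    refine hpoint N x hx.1 (lt_of_le_of_lt ?_ (hx.2 N le_rfl))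
    exact le_mul_of_one_le_left measureReal_nonneg hR
  have hTD : ∀ N, ∀ x ∈ G N, ‖T (N + 1) x‖ ≤ lam := by
    intro N x hx
    refine hpoint (N + 1) x hx.1 ?_
    have h1 := hx.2 N le_rfl
    have h2 := hreg N x
    have h3 : μ.real (E ∩ c (N + 1) ⁻¹' {c (N + 1) x}) ≤ μ.real (E ∩ c N ⁻¹' {c N x}) := by
      refine measureReal_mono (Set.inter_subset_inter_right _ ?_)
        (hfin (Set.inter_subset_right.trans (hfibA N x hx.1)))
      intro y hy
      exact href N y x hy
    nlinarith
  have hDsub : ∀ N, G N \ G (N + 1) ⊆ A := fun N => Set.sdiff_subset.trans (hGA N)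
  have hDbad : ∀ N, μ.real (G N \ G (N + 1)) ≤ R * μ.real (E ∩ (G N \ G (N + 1))) := by
    intro N
    set D := G N \ G (N + 1) with hD
    have hDsat : ∀ x y, c (N + 1) x = c (N + 1) y → x ∈ D → y ∈ D := by
      rintro x y h ⟨hx1, hx2⟩
      exact ⟨hGsat N x y (href N x y h) hx1, fun hy => hx2 (hGsat (N + 1) y x h.symm hy)⟩
    have hDm : MeasurableSet D := (hGm N).diff (hGm (N + 1))
    have hDf : μ D ≠ ⊤ := hfin (hDsub N)
    have s1 := hasSum_setIntegral_fibers (μ := μ) (hc (N + 1)) hDm (u := fun _ => (1 : ℝ))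
      (integrableOn_const hDf)
    have s2 := hasSum_setIntegral_fibers (μ := μ) (hc (N + 1)) (hDm.inter hE)
      (u := fun _ => R)
      (integrableOn_const (measure_ne_top_of_subset Set.inter_subset_left hDf))
    have := hasSum_le (fun a => ?_) s1 s2
    · simp only [setIntegral_const, smul_eq_mul, mul_one] at this
      rw [Set.inter_comm, mul_comm] 
      exact this
    · simp only [setIntegral_const, smul_eq_mul, mul_one]
      by_cases hne : (D ∩ c (N + 1) ⁻¹' {a}).Nonempty
      · obtain ⟨x, hx, rfl⟩ := hne
        have hQ : c (N + 1) ⁻¹' {c (N + 1) x} ⊆ D := fun y hy => hDsat x y hy.symm hx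
        rw [Set.inter_eq_right.2 hQ, Set.inter_comm D E, Set.inter_assoc,
          Set.inter_eq_right.2 hQ]
        by_contra! hcon
        refine hx.2 ⟨hx.1.1, fun k hk => ?_⟩
        rcases Nat.lt_or_eq_of_le hk with hk | rfl
        · exact hx.1.2 k (by omega)
        · rwa [mul_comm]
      · rw [Set.not_nonempty_iff_eq_empty] at hne
        rw [Set.inter_right_comm, hne]
        simp
  have hstep : ∀ N, ‖∫ x in G N, T N x ∂μ - ∫ x in G (N + 1), T (N + 1) x ∂μ‖ ≤
      lam * μ.real (G N \ G (N + 1)) := by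
    intro N
    rw [setIntegral_eq_of_fibers (hc N) (hGsat N) ((hTint N).mono_set (hGA N))
      ((hTint (N + 1)).mono_set (hGA N)) fun a => (hmart N a).symm,
      ← setIntegral_sdiff (hGm (N + 1)) ((hTint (N + 1)).mono_set (hGA N))
      (hGsucc N)]
    exact norm_setIntegral_le_of_norm_le_const (hfin (hDsub N)).lt_top
      (fun x hx => hTD N x hx.1)
  have hU : ∀ N, A \ G (N + 1) = (A \ G N) ∪ (G N \ G (N + 1)) := fun N => by
    rw [Set.sdiff_union_sdiff_cancel (hGA N) (hGsucc N)]
  have hdisj : ∀ N, Disjoint (A \ G N) (G N \ G (N + 1)) := fun N =>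
    Set.disjoint_left.2 fun x hx hy => hx.2 hy.1
  have hsub : ∀ N, IntegrableOn (fun x => T N x - F x) A μ := fun N =>
    Integrable.sub (hTint N) hF
  have hmeas : ∀ N, μ.real (A \ G N) ≤ R * μ.real (E ∩ (A \ G N)) := by
    intro N
    induction N with
    | zero => simp [hG0]
    | succ N ih =>
      rw [hU N, Set.inter_union_distrib_left,
        measureReal_union (hdisj N) ((hGm N).diff (hGm (N + 1))) (hfin Set.sdiff_subset)
          (hfin (hDsub N)),
        measureReal_union ((hdisj N).mono Set.inter_subset_right Set.inter_subset_right)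
          (hE.inter ((hGm N).diff (hGm (N + 1))))
          (hfin (Set.inter_subset_right.trans Set.sdiff_subset))
          (hfin (Set.inter_subset_right.trans (hDsub N)))]
      linarith [hDbad N]
  have htel : ∀ N, ‖∫ x in A, T 0 x ∂μ - ∫ x in G N, T N x ∂μ‖ ≤ lam * μ.real (A \ G N) := by
    intro N
    induction N with
    | zero => simp [hG0]
    | succ N ih =>
      rw [hU N, measureReal_union (hdisj N) ((hGm N).diff (hGm (N + 1))) (hfin Set.sdiff_subset)
          (hfin (hDsub N)), mul_add]
      exact (norm_sub_le_norm_sub_add_norm_sub _ _ _).trans (add_le_add ih (hstep N))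
  set e := μ.real (E ∩ A) with he
  have he0 : 0 ≤ e := measureReal_nonneg
  have hsmallA : ∀ N, μ.real (A \ G N) ≤ R * e := fun N =>
    (hmeas N).trans (mul_le_mul_of_nonneg_left (measureReal_mono
      (Set.inter_subset_inter_right _ Set.sdiff_subset) (hfin Set.inter_subset_right))
      (by linarith))
  have hdct : Tendsto (fun N => ∫ x in A \ E, ‖T N x - F x‖ ∂μ) atTop (𝓝 0) := by
    have hAE : MeasurableSet (A \ E) := hAm.diff hE
    have : Tendsto (fun N => ∫ x in A \ E, ‖T N x - F x‖ ∂μ) atTop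
        (𝓝 (∫ x in A \ E, (0 : ℝ) ∂μ)) := by
      refine tendsto_integral_of_dominated_convergence (fun _ => lam + lam) (fun N => ?_)
        (integrableOn_const (hfin Set.sdiff_subset)) (fun N => ?_) ?_
      · exact (IntegrableOn.mono_set (hsub N).norm Set.sdiff_subset).aestronglyMeasurable
      · refine (ae_restrict_iff' hAE).2 (ae_of_all _ fun x hx => ?_)
        rw [norm_norm]
        exact (norm_sub_le _ _).trans (add_le_add (hbound x hx.1 hx.2 N) (hFb x hx.1))
      · refine (ae_restrict_iff' hAE).2 ?_
        filter_upwards [hlim] with x hx hxA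
        have := (hx hxA.1 hxA.2).sub_const (F x)
        simpa using this.norm
    simpa using this
  have hcmp : ∀ N, ‖∫ x in A, T 0 x ∂μ - ∫ x in A, F x ∂μ‖ ≤
      4 * R * lam * e + ∫ x in A \ E, ‖T N x - F x‖ ∂μ := by
    intro N
    have e1 : ∫ x in A, F x ∂μ = ∫ x in G N, F x ∂μ + ∫ x in A \ G N, F x ∂μ := by
      rw [setIntegral_sdiff (hGm N) hF (hGA N)]; ring
    have e2 : ∫ x in G N, T N x ∂μ - ∫ x in G N, F x ∂μ =
        ∫ x in G N ∩ E, (T N x - F x) ∂μ + ∫ x in G N \ E, (T N x - F x) ∂μ := by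
      rw [integral_inter_add_sdiff hE ((hsub N).mono_set (hGA N)), integral_sub
        ((hTint N).mono_set (hGA N)) (hF.mono_set (hGA N))]
    have b1 : ‖∫ x in A \ G N, F x ∂μ‖ ≤ lam * μ.real (A \ G N) :=
      norm_setIntegral_le_of_norm_le_const (hfin Set.sdiff_subset).lt_top fun x hx => hFb x hx.1
    have b2 : ‖∫ x in G N ∩ E, (T N x - F x) ∂μ‖ ≤ (lam + lam) * e := by
      refine (norm_setIntegral_le_of_norm_le_const
        (hfin (Set.inter_subset_left.trans (hGA N))).lt_top fun x hx =>
        (norm_sub_le _ _).trans (add_le_add (hTG N x hx.1) (hFb x hx.1.1))).trans ?_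
      refine mul_le_mul_of_nonneg_left (measureReal_mono ?_ (hfin Set.inter_subset_right))
        (by linarith)
      exact fun x hx => ⟨hx.2, hx.1.1⟩
    have b3 : ‖∫ x in G N \ E, (T N x - F x) ∂μ‖ ≤ ∫ x in A \ E, ‖T N x - F x‖ ∂μ := by
      refine (norm_integral_le_integral_norm _).trans ?_
      refine setIntegral_mono_set (IntegrableOn.mono_set (hsub N).norm Set.sdiff_subset)
        (ae_of_all _ fun x => norm_nonneg _) ?_
      exact (Set.sdiff_subset_sdiff_left (hGA N)).eventuallyLE
    have b0 := htel N
    have hs := mul_le_mul_of_nonneg_left (hsmallA N) hlam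
    have e3 : ∫ x in A, T 0 x ∂μ - ∫ x in A, F x ∂μ =
        (∫ x in A, T 0 x ∂μ - ∫ x in G N, T N x ∂μ) + (∫ x in G N ∩ E, (T N x - F x) ∂μ)
          + (∫ x in G N \ E, (T N x - F x) ∂μ) - ∫ x in A \ G N, F x ∂μ := by
      rw [e1]; linear_combination e2
    have hle : lam * e ≤ R * (lam * e) :=
      le_mul_of_one_le_left (mul_nonneg hlam he0) hR
    rw [e3]
    refine (norm_sub_le _ _).trans ?_
    refine (add_le_add_left (norm_add₃_le) _).trans ?_
    nlinarith
  have := ge_of_tendsto' (hdct.const_add (4 * R * lam * e)) hcmp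
  simpa using this

theorem mseq_succ (p : ℕ → ℕ) (k : ℕ) : mseq p (k + 1) = mseq p k * p k :=
  Finset.prod_range_succ _ _

theorem mseq_dvd (p : ℕ → ℕ) {k l : ℕ} (hkl : k ≤ l) : mseq p k ∣ mseq p l :=
  Finset.prod_dvd_prod_of_subset _ _ _ (Finset.range_mono hkl)

theorem mseq_pos {p : ℕ → ℕ} (hp : ∀ i, 2 ≤ p i) (k : ℕ) : 0 < mseq p k :=
  Finset.prod_pos fun i _ => lt_of_lt_of_le two_pos (hp i)

theorem mseq_mono {p : ℕ → ℕ} (hp : ∀ i, 2 ≤ p i) : Monotone (mseq p) := fun _ l hkl =>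
  Nat.le_of_dvd (mseq_pos hp l) (mseq_dvd p hkl)

theorem lt_mseq {p : ℕ → ℕ} (hp : ∀ i, 2 ≤ p i) (k : ℕ) : k < mseq p k := by
  induction k with
  | zero => simp [mseq]
  | succ k ih =>
    rw [mseq_succ]
    nlinarith [hp k]

theorem eTwoPi_add (s t : ℝ) : eTwoPi (s + t) = eTwoPi s * eTwoPi t := by
  simp only [eTwoPi, Complex.ofReal_add, mul_add, Complex.exp_add]

theorem eTwoPi_intCast (n : ℤ) : eTwoPi n = 1 := by
  rw [eTwoPi, Complex.exp_eq_one_iff]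
  exact ⟨n, by push_cast; ring⟩

theorem eTwoPi_add_intCast (t : ℝ) (n : ℤ) : eTwoPi (t + n) = eTwoPi t := by
  rw [eTwoPi_add, eTwoPi_intCast, mul_one]

theorem eTwoPi_zero : eTwoPi 0 = 1 := by simp [eTwoPi]

theorem eTwoPi_sum (L : ℕ) (g : ℕ → ℝ) :
    eTwoPi (∑ j ∈ Finset.range L, g j) = ∏ j ∈ Finset.range L, eTwoPi (g j) := by
  induction L with
  | zero => simp [eTwoPi_zero]
  | succ L ih => rw [Finset.sum_range_succ, eTwoPi_add, ih, Finset.prod_range_succ]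

theorem conj_eTwoPi (t : ℝ) : (starRingEnd ℂ) (eTwoPi t) = eTwoPi (-t) := by
  rw [eTwoPi, eTwoPi, ← Complex.exp_conj]
  congr 1
  simp only [map_mul, Complex.conj_I, Complex.conj_ofReal, map_ofNat]
  push_cast
  ring

theorem norm_eTwoPi (t : ℝ) : ‖eTwoPi t‖ = 1 := by
  have : eTwoPi t = Complex.exp (((2 * Real.pi * t : ℝ) : ℂ) * Complex.I) := by
    rw [eTwoPi]
    congr 1
    push_cast
    ring
  rw [this, Complex.norm_exp_ofReal_mul_I]

theorem measurable_eTwoPi : Measurable eTwoPi := by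
  unfold eTwoPi
  fun_prop

theorem eTwoPi_div_ne_one {a : ℤ} {q : ℕ} (hq : q ≠ 0) (ha : ¬ (q : ℤ) ∣ a) :
    eTwoPi ((a : ℝ) / q) ≠ 1 := by
  intro h
  rw [eTwoPi, Complex.exp_eq_one_iff] at h
  obtain ⟨n, hn⟩ := h
  refine ha ⟨n, ?_⟩
  have h2 : (((a : ℝ) / q : ℝ) : ℂ) = n := by
    have h3 : (2 * (Real.pi : ℂ) * Complex.I) ≠ 0 := Complex.two_pi_I_ne_zero
    refine mul_left_cancel₀ h3 (hn.trans (by ring))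
  have h4 : (a : ℝ) / q = n := by exact_mod_cast h2
  rw [div_eq_iff (by exact_mod_cast hq)] at h4
  have h5 : a = n * q := by exact_mod_cast h4
  rw [h5, mul_comm]

/-- The character with frequency digits `γ i`, `i < L`. -/
def chi (p : ℕ → ℕ) (γ : ℕ → ℤ) (L : ℕ) (x : ℝ) : ℂ :=
  ∏ i ∈ Finset.range L, eTwoPi ((γ i : ℝ) * ⌊x * (mseq p (i + 1) : ℝ)⌋ / (p i : ℝ))

theorem eTwoPi_mul_emod_div {q : ℕ} (hq : q ≠ 0) (a n : ℤ) :
    eTwoPi ((a : ℝ) * ((n % (q : ℤ)).toNat : ℝ) / q) = eTwoPi ((a : ℝ) * n / q) := by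
  have h1 : (((n % (q : ℤ)).toNat : ℤ) : ℤ) = n % q :=
    Int.toNat_of_nonneg (Int.emod_nonneg _ (by exact_mod_cast hq))
  have h2 : ((n % (q : ℤ)).toNat : ℝ) = ((n % (q : ℤ) : ℤ) : ℝ) := by exact_mod_cast h1
  have h3 : (n : ℝ) = ((n % (q : ℤ) : ℤ) : ℝ) + q * ((n / (q : ℤ) : ℤ) : ℝ) := by
    exact_mod_cast (Int.emod_add_mul_ediv n q).symm
  have hq' : (q : ℝ) ≠ 0 := by exact_mod_cast hq
  rw [h2, ← eTwoPi_add_intCast _ (a * (n / (q : ℤ)))]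
  congr 1
  rw [h3]
  push_cast
  field_simp

theorem price_eq_chi {p : ℕ → ℕ} (hp : ∀ i, 2 ≤ p i) {k L : ℕ} (hk : k < mseq p L) (x : ℝ) :
    price p k x = chi p (fun i => ((k / mseq p i % p i : ℕ) : ℤ)) L x := by
  have key : ∀ K, k < mseq p K →
      (∑ j ∈ Finset.range K, (((k / mseq p j) % p j : ℕ) : ℝ) * (pdigit p x j : ℝ) / (p j : ℝ))
        = ∑ j ∈ Finset.range (max (k + 1) L),
          (((k / mseq p j) % p j : ℕ) : ℝ) * (pdigit p x j : ℝ) / (p j : ℝ) ∨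
      max (k + 1) L < K := by
    intro K hK
    rcases lt_or_ge (max (k + 1) L) K with h | h
    · exact Or.inr h
    · refine Or.inl (Finset.sum_subset (Finset.range_mono h) fun j _ hj => ?_)
      have : k / mseq p j = 0 := Nat.div_eq_of_lt
        (hK.trans_le (mseq_mono hp (by simpa using hj)))
      simp [this]
  have h1 := (key (k + 1) ((Nat.lt_succ_self k).trans (lt_mseq hp _))).resolve_right (by simp)
  have h2 := (key L hk).resolve_right (by simp)
  rw [price, h1, ← h2, chi]
  rw [eTwoPi_sum]
  refine Finset.prod_congr rfl fun i _ => ?_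
  have := eTwoPi_mul_emod_div (q := p i) (by have := hp i; omega)
    ((k / mseq p i % p i : ℕ) : ℤ) ⌊x * (mseq p (i + 1) : ℝ)⌋
  simpa only [pdigit, Int.cast_natCast] using this

theorem chi_mul_conj (p : ℕ → ℕ) (α β : ℕ → ℤ) (L : ℕ) (x : ℝ) :
    chi p α L x * (starRingEnd ℂ) (chi p β L x) = chi p (fun i => α i - β i) L x := by
  rw [chi, chi, chi, map_prod, ← Finset.prod_mul_distrib]
  refine Finset.prod_congr rfl fun i _ => ?_
  rw [conj_eTwoPi, ← eTwoPi_add]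
  congr 1
  push_cast
  ring

theorem measurable_chi (p : ℕ → ℕ) (γ : ℕ → ℤ) (L : ℕ) : Measurable (chi p γ L) := by
  unfold chi
  refine Finset.measurable_prod _ fun i _ => measurable_eTwoPi.comp ?_
  have : Measurable fun x : ℝ => ((⌊x * (mseq p (i + 1) : ℝ)⌋ : ℤ) : ℝ) :=
    (Measurable.of_discrete (f := fun n : ℤ => (n : ℝ))).comp
      (Int.measurable_floor.comp (measurable_id.mul_const _))
  exact (this.const_mul _).div_const _

theorem floor_shift {p : ℕ → ℕ} (hp : ∀ i, 2 ≤ p i) {K l : ℕ} (hK : K ≤ l) (x : ℝ) :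
    ⌊(x + 1 / (mseq p K : ℝ)) * (mseq p l : ℝ)⌋ =
      ⌊x * (mseq p l : ℝ)⌋ + ((mseq p l / mseq p K : ℕ) : ℤ) := by
  have h0 : (mseq p K : ℝ) ≠ 0 := by exact_mod_cast (mseq_pos hp K).ne'
  rw [← Int.floor_add_natCast, Nat.cast_div (mseq_dvd p hK) h0]
  congr 1
  ring

theorem factor_shift {p : ℕ → ℕ} (hp : ∀ i, 2 ≤ p i) {K i : ℕ} (hK : K ≤ i) (a : ℤ) (x : ℝ) :
    eTwoPi ((a : ℝ) * ⌊(x + 1 / (mseq p K : ℝ)) * (mseq p (i + 1) : ℝ)⌋ / (p i : ℝ)) =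
      eTwoPi ((a : ℝ) * ⌊x * (mseq p (i + 1) : ℝ)⌋ / (p i : ℝ)) := by
  have hpi : (p i : ℝ) ≠ 0 := by have := hp i; exact_mod_cast (by omega)
  rw [floor_shift hp (by omega : K ≤ i + 1), mseq_succ, Nat.mul_div_right_comm (mseq_dvd p hK),
    ← eTwoPi_add_intCast (_ * (⌊_⌋ : ℝ) / _) (a * (mseq p i / mseq p K : ℕ))]
  congr 1
  push_cast
  field_simp

theorem intervalIntegral_chi_eq_zero {p : ℕ → ℕ} (hp : ∀ i, 2 ≤ p i) {γ : ℕ → ℤ} {K N L : ℕ}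
    (hKN : K ≤ N) (hNL : N < L) (hγ : ∀ i < N, γ i = 0) (hN : ¬ (p N : ℤ) ∣ γ N) (a : ℝ) :
    ∫ x in a..(a + 1 / (mseq p K : ℝ)), chi p γ L x = 0 := by
  have hpN : p N ≠ 0 := by have := hp N; omega
  have hpN' : (p N : ℝ) ≠ 0 := by exact_mod_cast hpN
  have hper : Function.Periodic (chi p γ L) (1 / (mseq p K : ℝ)) := by
    intro x
    refine Finset.prod_congr rfl fun i _ => ?_
    rcases lt_or_ge i N with h | h
    · simp [hγ i h]
    · exact factor_shift hp (hKN.trans h) _ _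
  have hrot : ∀ x, chi p γ L (x + 1 / (mseq p (N + 1) : ℝ)) =
      eTwoPi ((γ N : ℝ) / p N) * chi p γ L x := by
    intro x
    have hmem : N ∈ Finset.range L := Finset.mem_range.2 hNL
    rw [chi, chi, ← Finset.mul_prod_erase _ _ hmem, ← Finset.mul_prod_erase _ _ hmem, ← mul_assoc]
    congr 1
    · rw [← eTwoPi_add, floor_shift hp le_rfl, Nat.div_self (mseq_pos hp _)]
      congr 1
      push_cast
      ring
    · refine Finset.prod_congr rfl fun i hi => ?_
      rcases lt_or_ge i N with h | h
      · simp [hγ i h]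
      · have := Finset.ne_of_mem_erase hi
        exact factor_shift hp (by omega) _ _
  have h1 := intervalIntegral.integral_comp_add_right (a := a) (b := a + 1 / (mseq p K : ℝ))
    (chi p γ L) (1 / (mseq p (N + 1) : ℝ))
  rw [add_right_comm, hper.intervalIntegral_add_eq _ a] at h1
  simp only [hrot, intervalIntegral.integral_const_mul] at h1
  by_contra hne
  exact eTwoPi_div_ne_one hpN hN (mul_right_cancel₀ hne (h1.trans (one_mul _).symm))

theorem norm_price {p : ℕ → ℕ} (k : ℕ) (x : ℝ) : ‖price p k x‖ = 1 := norm_eTwoPi _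

theorem measurable_price {p : ℕ → ℕ} (hp : ∀ i, 2 ≤ p i) (k : ℕ) : Measurable (price p k) := by
  rw [funext (price_eq_chi hp (lt_mseq hp k))]
  exact measurable_chi _ _ _

theorem floor_eq_of_le {p : ℕ → ℕ} (hp : ∀ i, 2 ≤ p i) {K N : ℕ} (hKN : K ≤ N) {x y : ℝ}
    (hxy : ⌊x * (mseq p N : ℝ)⌋ = ⌊y * (mseq p N : ℝ)⌋) :
    ⌊x * (mseq p K : ℝ)⌋ = ⌊y * (mseq p K : ℝ)⌋ := by
  have key : ∀ z : ℝ, ⌊z * (mseq p K : ℝ)⌋ =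
      ⌊z * (mseq p N : ℝ)⌋ / ((mseq p N / mseq p K : ℕ) : ℤ) := by
    intro z
    have h0 : (mseq p K : ℝ) ≠ 0 := by exact_mod_cast (mseq_pos hp K).ne'
    have h1 : (mseq p N : ℝ) ≠ 0 := by exact_mod_cast (mseq_pos hp N).ne'
    rw [← Int.floor_div_natCast, Nat.cast_div (mseq_dvd p hKN) h0]
    congr 1
    field_simp
  rw [key, key, hxy]

theorem chi_congr {p : ℕ → ℕ} (hp : ∀ i, 2 ≤ p i) (γ : ℕ → ℤ) {N : ℕ} {x y : ℝ}
    (hxy : ⌊x * (mseq p N : ℝ)⌋ = ⌊y * (mseq p N : ℝ)⌋) : chi p γ N x = chi p γ N y := by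
  refine Finset.prod_congr rfl fun i hi => ?_
  rw [floor_eq_of_le hp (Finset.mem_range.1 hi) hxy]

theorem price_congr {p : ℕ → ℕ} (hp : ∀ i, 2 ≤ p i) {k N : ℕ} (hk : k < mseq p N) {x y : ℝ}
    (hxy : ⌊x * (mseq p N : ℝ)⌋ = ⌊y * (mseq p N : ℝ)⌋) : price p k x = price p k y := by
  rw [price_eq_chi hp hk, price_eq_chi hp hk, chi_congr hp _ hxy]

theorem floor_mul_mseq_eq_iff {p : ℕ → ℕ} (hp : ∀ i, 2 ≤ p i) (N : ℕ) (a : ℤ) (x : ℝ) :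
    ⌊x * (mseq p N : ℝ)⌋ = a ↔
      x ∈ Set.Ico ((a : ℝ) / (mseq p N : ℝ)) (((a : ℝ) + 1) / (mseq p N : ℝ)) := by
  have h0 : (0 : ℝ) < mseq p N := by exact_mod_cast mseq_pos hp N
  rw [Int.floor_eq_iff, Set.mem_Ico, div_le_iff₀ h0, lt_div_iff₀ h0]

theorem setIntegral_price_eq_zero {p : ℕ → ℕ} (hp : ∀ i, 2 ≤ p i) {k N : ℕ}
    (hk : mseq p N ≤ k) (hk' : k < mseq p (N + 1)) (a : ℤ) :
    ∫ x in Set.Ico ((a : ℝ) / (mseq p N : ℝ)) (((a : ℝ) + 1) / (mseq p N : ℝ)),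
      price p k x = 0 := by
  have h0 : (0 : ℝ) < mseq p N := by exact_mod_cast mseq_pos hp N
  set γ : ℕ → ℤ := fun i => ((k / mseq p i % p i : ℕ) : ℤ) with hγ
  set γ' : ℕ → ℤ := fun i => if i < N then 0 else γ i with hγ'
  have hchi : ∀ x, chi p γ (N + 1) x = chi p γ N x * chi p γ' (N + 1) x := by
    intro x
    rw [chi, chi, chi, Finset.prod_range_succ, Finset.prod_range_succ]
    congr 1
    rw [Finset.prod_eq_one, one_mul]
    · simp [hγ']
    · intro i hi
      simp [hγ', Finset.mem_range.1 hi, eTwoPi_zero]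
  have hdig : k / mseq p N < p N := by
    rw [Nat.div_lt_iff_lt_mul (mseq_pos hp N), mul_comm, ← mseq_succ]
    exact hk'
  have hdig0 : 0 < k / mseq p N := Nat.div_pos hk (mseq_pos hp N)
  have hz : ∫ x in Set.Ico ((a : ℝ) / (mseq p N : ℝ)) (((a : ℝ) + 1) / (mseq p N : ℝ)),
      chi p γ' (N + 1) x = 0 := by
    have := intervalIntegral_chi_eq_zero hp (γ := γ') (K := N) (N := N) (L := N + 1) le_rfl
      (Nat.lt_succ_self N) (fun i hi => by simp [hγ', hi])
      (by
        simp only [hγ', lt_irrefl, if_false, hγ, Nat.mod_eq_of_lt hdig]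
        exact_mod_cast Nat.not_dvd_of_pos_of_lt hdig0 hdig) ((a : ℝ) / (mseq p N : ℝ))
    rw [← add_div, intervalIntegral.integral_of_le (by gcongr; linarith),
      ← integral_Ico_eq_integral_Ioc] at this
    exact this
  have hcongr : ∀ x ∈ Set.Ico ((a : ℝ) / (mseq p N : ℝ)) (((a : ℝ) + 1) / (mseq p N : ℝ)),
      price p k x = chi p γ N ((a : ℝ) / (mseq p N : ℝ)) * chi p γ' (N + 1) x := by
    intro x hx
    rw [price_eq_chi hp hk', hchi]
    congr 1
    refine chi_congr hp _ ?_
    rw [(floor_mul_mseq_eq_iff hp N a x).2 hx, div_mul_cancel₀ _ h0.ne', Int.floor_intCast]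
  rw [setIntegral_congr_fun measurableSet_Ico hcongr, integral_const_mul, hz, mul_zero]

theorem eq_of_digits_eq {p : ℕ → ℕ} {k l L : ℕ} (hk : k < mseq p L)
    (hl : l < mseq p L) (h : ∀ i < L, k / mseq p i % p i = l / mseq p i % p i) : k = l := by
  have key : ∀ i ≤ L, k / mseq p (L - i) = l / mseq p (L - i) := by
    intro i
    induction i with
    | zero => simp [Nat.div_eq_of_lt hk, Nat.div_eq_of_lt hl]
    | succ i ih =>
      intro hi
      have h1 := ih (by omega)
      have h2 := h (L - (i + 1)) (by omega)
      rw [show L - i = L - (i + 1) + 1 by omega, mseq_succ, ← Nat.div_div_eq_div_mul,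
        ← Nat.div_div_eq_div_mul] at h1
      rw [← Nat.div_add_mod (k / _) (p (L - (i + 1))), h1, h2, Nat.div_add_mod]
  simpa [mseq] using key L le_rfl

theorem setIntegral_price_mul_conj {p : ℕ → ℕ} (hp : ∀ i, 2 ≤ p i) (k l : ℕ) :
    ∫ x in Set.Icc (0 : ℝ) 1, price p k x * (starRingEnd ℂ) (price p l x) =
      if k = l then 1 else 0 := by
  split_ifs with hkl
  · subst hkl
    simp [Complex.mul_conj, Complex.normSq_eq_norm_sq, norm_price]
  · set L := k + l
    have hk : k < mseq p L := (lt_mseq hp k).trans_le (mseq_mono hp (by omega))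
    have hl : l < mseq p L := (lt_mseq hp l).trans_le (mseq_mono hp (by omega))
    have hex : ∃ i, i < L ∧ k / mseq p i % p i ≠ l / mseq p i % p i := by
      by_contra! hcon
      exact hkl (eq_of_digits_eq hk hl hcon)
    classical
    set N := Nat.find hex
    obtain ⟨hNL, hNne⟩ := Nat.find_spec hex
    have hlow : ∀ i < N, k / mseq p i % p i = l / mseq p i % p i := by
      intro i hi
      by_contra hne
      exact Nat.find_min hex hi ⟨by omega, hne⟩
    have hfun : ∀ x, price p k x * (starRingEnd ℂ) (price p l x) =
        chi p (fun i => ((k / mseq p i % p i : ℕ) : ℤ) - ((l / mseq p i % p i : ℕ) : ℤ)) L x := by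
      intro x
      rw [price_eq_chi hp hk, price_eq_chi hp hl, chi_mul_conj]
    simp only [hfun]
    have := intervalIntegral_chi_eq_zero hp (γ := fun i =>
      ((k / mseq p i % p i : ℕ) : ℤ) - ((l / mseq p i % p i : ℕ) : ℤ))
      (K := 0) (N := N) (L := L) (Nat.zero_le _) hNL
      (fun i hi => by simp [hlow i hi])
      (by
        intro hdvd
        refine hNne ?_
        have h1 := Nat.modEq_iff_dvd.2 hdvd
        rw [Nat.ModEq, Nat.mod_mod, Nat.mod_mod] at h1
        exact h1.symm) 0
    rw [integral_Icc_eq_integral_Ioc, ← intervalIntegral.integral_of_le zero_le_one]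
    simpa [mseq] using this

/-- The index of the half-open `𝒫`-adic parallelepiped of rank `N` containing `x`. -/
def cellIndex {d : ℕ} (p : Fin d → ℕ → ℕ) (N : ℕ) (x : Fin d → ℝ) : Fin d → ℤ :=
  fun j => ⌊x j * (mseq (p j) N : ℝ)⌋

section Multi

variable {d : ℕ} {p : Fin d → ℕ → ℕ}

theorem measurable_cellIndex (p : Fin d → ℕ → ℕ) (N : ℕ) : Measurable (cellIndex p N) :=
  measurable_pi_lambda _ fun j =>
    Int.measurable_floor.comp ((measurable_pi_apply j).mul_const _)

theorem cellIndex_preimage (hp : ∀ j i, 2 ≤ p j i) (N : ℕ) (a : Fin d → ℤ) :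
    cellIndex p N ⁻¹' {a} = Set.univ.pi fun j =>
      Set.Ico ((a j : ℝ) / (mseq (p j) N : ℝ)) (((a j : ℝ) + 1) / (mseq (p j) N : ℝ)) := by
  ext x
  simp only [Set.mem_preimage, Set.mem_singleton_iff, funext_iff, Set.mem_univ_pi]
  exact forall_congr' fun j => floor_mul_mseq_eq_iff (hp j) N (a j) (x j)

theorem cellIndex_eq_of_le (hp : ∀ j i, 2 ≤ p j i) {K N : ℕ} (hKN : K ≤ N) {x y : Fin d → ℝ}
    (h : cellIndex p N x = cellIndex p N y) : cellIndex p K x = cellIndex p K y :=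
  funext fun j => floor_eq_of_le (hp j) hKN (congrFun h j)

theorem cellIndex_preimage_subset_cell (hp : ∀ j i, 2 ≤ p j i) (N : ℕ) (a : Fin d → ℤ) :
    cellIndex p N ⁻¹' {a} ⊆ cell p N a := by
  rw [cellIndex_preimage hp]
  exact Set.pi_mono fun j _ => Set.Ico_subset_Icc_self

theorem cellIndex_preimage_ae_eq_cell (hp : ∀ j i, 2 ≤ p j i) (N : ℕ) (a : Fin d → ℤ) :
    cellIndex p N ⁻¹' {a} =ᵐ[volume] cell p N a := by
  rw [cellIndex_preimage hp, cell, Set.pi_univ_Icc]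
  exact Measure.univ_pi_Ico_ae_eq_Icc

theorem volume_real_cellIndex_preimage (hp : ∀ j i, 2 ≤ p j i) (N : ℕ) (a : Fin d → ℤ) :
    volume.real (cellIndex p N ⁻¹' {a}) = ∏ j, (1 / (mseq (p j) N : ℝ)) := by
  rw [cellIndex_preimage hp, measureReal_def, Real.volume_pi_Ico_toReal]
  · exact Finset.prod_congr rfl fun j _ => by ring
  · intro j
    have : (0 : ℝ) < mseq (p j) N := by exact_mod_cast mseq_pos (hp j) N
    show (a j : ℝ) / _ ≤ ((a j : ℝ) + 1) / _
    gcongr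
    linarith

theorem volume_cell_regular (hp : ∀ j i, 2 ≤ p j i) {M : ℕ} (hM : ∀ j i, p j i ≤ M) (N : ℕ)
    (a b : Fin d → ℤ) :
    volume.real (cellIndex p N ⁻¹' {a}) ≤
      ((M : ℝ) + 1) ^ d * volume.real (cellIndex p (N + 1) ⁻¹' {b}) := by
  rw [volume_real_cellIndex_preimage hp, volume_real_cellIndex_preimage hp]
  have : ((M : ℝ) + 1) ^ d = ∏ _j : Fin d, ((M : ℝ) + 1) := by simp
  rw [this, ← Finset.prod_mul_distrib]
  refine Finset.prod_le_prod (fun j _ => by positivity) fun j _ => ?_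
  have h0 : (0 : ℝ) < mseq (p j) N := by exact_mod_cast mseq_pos (hp j) N
  have h1 : (0 : ℝ) < p j N := by have := hp j N; exact_mod_cast (by omega)
  have h2 : (p j N : ℝ) ≤ M := by exact_mod_cast hM j N
  rw [mseq_succ, Nat.cast_mul, mul_one_div, div_le_div_iff₀ h0 (by positivity)]
  nlinarith

theorem volume_cell_regular_add (hp : ∀ j i, 2 ≤ p j i) {M : ℕ} (hM : ∀ j i, p j i ≤ M)
    (N K : ℕ) (a b : Fin d → ℤ) :
    volume.real (cellIndex p N ⁻¹' {a}) ≤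
      (((M : ℝ) + 1) ^ d) ^ K * volume.real (cellIndex p (N + K) ⁻¹' {b}) := by
  induction K generalizing b with
  | zero => simp [volume_real_cellIndex_preimage hp]
  | succ K ih =>
    refine (ih b).trans ?_
    rw [pow_succ, mul_assoc]
    exact mul_le_mul_of_nonneg_left (volume_cell_regular hp hM (N + K) b b) (by positivity)

theorem norm_priceD (n : Fin d → ℕ) (x : Fin d → ℝ) : ‖priceD p n x‖ = 1 := by
  rw [priceD, norm_prod]
  exact Finset.prod_eq_one fun j _ => norm_price _ _

theorem measurable_priceD (hp : ∀ j i, 2 ≤ p j i) (n : Fin d → ℕ) : Measurable (priceD p n) :=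
  Finset.measurable_prod _ fun j _ => (measurable_price (hp j) _).comp (measurable_pi_apply j)

theorem measurable_priceSum (hp : ∀ j i, 2 ≤ p j i) (b : (Fin d → ℕ) → ℂ) (N : ℕ) :
    Measurable (priceSum p b N) :=
  Finset.measurable_sum _ fun n _ => (measurable_priceD hp n).const_mul _

theorem norm_priceSum_le (b : (Fin d → ℕ) → ℂ) (N : ℕ) (x : Fin d → ℝ) :
    ‖priceSum p b N x‖ ≤
      ∑ n ∈ Fintype.piFinset (fun j => Finset.range (mseq (p j) N)), ‖b n‖ :=
  (norm_sum_le _ _).trans (Finset.sum_le_sum fun n _ => by rw [norm_mul, norm_priceD, mul_one])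

theorem priceD_congr (hp : ∀ j i, 2 ≤ p j i) {n : Fin d → ℕ} {N : ℕ}
    (hn : ∀ j, n j < mseq (p j) N) {x y : Fin d → ℝ} (h : cellIndex p N x = cellIndex p N y) :
    priceD p n x = priceD p n y :=
  Finset.prod_congr rfl fun j _ => price_congr (hp j) (hn j) (congrFun h j)

theorem priceSum_congr (hp : ∀ j i, 2 ≤ p j i) (b : (Fin d → ℕ) → ℂ) {N : ℕ} {x y : Fin d → ℝ}
    (h : cellIndex p N x = cellIndex p N y) : priceSum p b N x = priceSum p b N y :=
  Finset.sum_congr rfl fun n hn => by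
    rw [priceD_congr hp (fun j => Finset.mem_range.1 (Fintype.mem_piFinset.1 hn j)) h]

theorem integrableOn_priceD (hp : ∀ j i, 2 ≤ p j i) (n : Fin d → ℕ) {s : Set (Fin d → ℝ)}
    (hs : volume s ≠ ⊤) : IntegrableOn (priceD p n) s := by
  have : IsFiniteMeasure (volume.restrict s) := ⟨by simpa using hs.lt_top⟩
  exact Integrable.of_bound (measurable_priceD hp n).aestronglyMeasurable 1
    (ae_of_all _ fun x => (norm_priceD n x).le)

theorem volume_cellIndex_preimage_ne_top (hp : ∀ j i, 2 ≤ p j i) (N : ℕ) (a : Fin d → ℤ) :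
    volume (cellIndex p N ⁻¹' {a}) ≠ ⊤ := by
  rw [measure_congr (cellIndex_preimage_ae_eq_cell hp N a), cell, Set.pi_univ_Icc]
  exact measure_Icc_lt_top.ne

theorem setIntegral_priceD_eq_zero (hp : ∀ j i, 2 ≤ p j i) {n : Fin d → ℕ} {N : ℕ}
    (hn : ∀ j, n j < mseq (p j) (N + 1)) {j : Fin d} (hj : mseq (p j) N ≤ n j)
    (a : Fin d → ℤ) : ∫ x in cellIndex p N ⁻¹' {a}, priceD p n x = 0 := by
  rw [cellIndex_preimage hp, volume_pi, Measure.restrict_pi_pi]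
  unfold priceD
  rw [integral_fintype_prod_eq_prod (fun j => price (p j) (n j))]
  exact Finset.prod_eq_zero (Finset.mem_univ j)
    (setIntegral_price_eq_zero (hp j) hj (hn j) (a j))

theorem setIntegral_priceSum_succ (hp : ∀ j i, 2 ≤ p j i) (b : (Fin d → ℕ) → ℂ) (N : ℕ)
    (a : Fin d → ℤ) :
    ∫ x in cellIndex p N ⁻¹' {a}, priceSum p b (N + 1) x =
      ∫ x in cellIndex p N ⁻¹' {a}, priceSum p b N x := by
  have hi : ∀ n, IntegrableOn (fun x => b n * priceD p n x) (cellIndex p N ⁻¹' {a}) := fun n =>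
    Integrable.const_mul (integrableOn_priceD hp n (volume_cellIndex_preimage_ne_top hp N a)) _
  unfold priceSum
  rw [integral_finsetSum _ fun n _ => hi n, integral_finsetSum _ fun n _ => hi n]
  have hsub : Fintype.piFinset (fun j => Finset.range (mseq (p j) N)) ⊆
      Fintype.piFinset (fun j => Finset.range (mseq (p j) (N + 1))) :=
    Fintype.piFinset_subset _ _ fun j => Finset.range_mono (mseq_mono (hp j) (Nat.le_succ N))
  refine (Finset.sum_subset hsub fun n hn hn' => ?_).symm
  simp only [Fintype.mem_piFinset, Finset.mem_range, not_forall, not_lt] at hn hn'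
  obtain ⟨j, hj⟩ := hn'
  rw [integral_const_mul, setIntegral_priceD_eq_zero hp hn hj, mul_zero]

theorem setIntegral_priceSum_mul_conj_succ (hp : ∀ j i, 2 ≤ p j i) (b : (Fin d → ℕ) → ℂ)
    {n : Fin d → ℕ} {N : ℕ} (hn : ∀ j, n j < mseq (p j) N) (a : Fin d → ℤ) :
    ∫ x in cellIndex p N ⁻¹' {a}, priceSum p b (N + 1) x * (starRingEnd ℂ) (priceD p n x) =
      ∫ x in cellIndex p N ⁻¹' {a}, priceSum p b N x * (starRingEnd ℂ) (priceD p n x) := by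
  have hm : MeasurableSet (cellIndex p N ⁻¹' {a}) :=
    measurable_cellIndex p N (measurableSet_singleton a)
  rcases (cellIndex p N ⁻¹' {a}).eq_empty_or_nonempty with he | ⟨y, hy⟩
  · simp [he]
  · have hc : ∀ S : (Fin d → ℝ) → ℂ,
        ∫ x in cellIndex p N ⁻¹' {a}, S x * (starRingEnd ℂ) (priceD p n x) =
          (∫ x in cellIndex p N ⁻¹' {a}, S x) * (starRingEnd ℂ) (priceD p n y) := by
      intro S
      rw [← integral_mul_const]
      refine setIntegral_congr_fun hm fun x hx => ?_
      show S x * _ = S x * _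
      rw [priceD_congr hp hn (show cellIndex p N x = cellIndex p N y from hx.trans hy.symm)]
    rw [hc, hc, setIntegral_priceSum_succ hp]

theorem setIntegral_priceD_mul_conj (hp : ∀ j i, 2 ≤ p j i) (k n : Fin d → ℕ) :
    ∫ x in Set.Icc (0 : Fin d → ℝ) 1, priceD p k x * (starRingEnd ℂ) (priceD p n x) =
      if k = n then 1 else 0 := by
  rw [← Set.pi_univ_Icc, volume_pi, Measure.restrict_pi_pi]
  simp only [priceD, map_prod, ← Finset.prod_mul_distrib]
  rw [integral_fintype_prod_eq_prod
    (fun j t => price (p j) (k j) t * (starRingEnd ℂ) (price (p j) (n j) t))]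
  simp only [Pi.zero_apply, Pi.one_apply, setIntegral_price_mul_conj (hp _)]
  split_ifs with h
  · subst h; simp
  · obtain ⟨j, hj⟩ := Function.ne_iff.1 h
    exact Finset.prod_eq_zero (Finset.mem_univ j) (if_neg hj)

theorem integrableOn_priceSum_mul_conj (hp : ∀ j i, 2 ≤ p j i) (b : (Fin d → ℕ) → ℂ)
    (n : Fin d → ℕ) (N : ℕ) {s : Set (Fin d → ℝ)} (hs : volume s ≠ ⊤) :
    IntegrableOn (fun x => priceSum p b N x * (starRingEnd ℂ) (priceD p n x)) s := by
  have : IsFiniteMeasure (volume.restrict s) := ⟨by simpa using hs.lt_top⟩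
  refine Integrable.of_bound ((measurable_priceSum hp b N).mul
    (Complex.continuous_conj.measurable.comp (measurable_priceD hp n))).aestronglyMeasurable
    (∑ n ∈ Fintype.piFinset (fun j => Finset.range (mseq (p j) N)), ‖b n‖)
    (ae_of_all _ fun x => ?_)
  rw [norm_mul, RCLike.norm_conj, norm_priceD, mul_one]
  exact norm_priceSum_le b N x

theorem setIntegral_priceSum_mul_conj (hp : ∀ j i, 2 ≤ p j i) (b : (Fin d → ℕ) → ℂ)
    {n : Fin d → ℕ} {N : ℕ} (hn : ∀ j, n j < mseq (p j) N) :
    ∫ x in Set.Icc (0 : Fin d → ℝ) 1, priceSum p b N x * (starRingEnd ℂ) (priceD p n x) = b n := by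
  have : IsFiniteMeasure (volume.restrict (Set.Icc (0 : Fin d → ℝ) 1)) :=
    ⟨by simpa using measure_Icc_lt_top⟩
  have hi : ∀ k, IntegrableOn (fun x => b k * (priceD p k x * (starRingEnd ℂ) (priceD p n x)))
      (Set.Icc (0 : Fin d → ℝ) 1) := fun k =>
    Integrable.const_mul (Integrable.of_bound ((measurable_priceD hp k).mul
      (Complex.continuous_conj.measurable.comp
        (measurable_priceD hp n))).aestronglyMeasurable 1
      (ae_of_all _ fun x => by
        rw [Pi.mul_apply, Function.comp_apply, norm_mul, RCLike.norm_conj, norm_priceD,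
          norm_priceD, mul_one])) _
  simp only [priceSum, Finset.sum_mul, mul_assoc]
  rw [integral_finsetSum _ fun k _ => hi k]
  simp only [integral_const_mul, setIntegral_priceD_mul_conj hp, mul_ite, mul_one, mul_zero]
  rw [Finset.sum_ite_eq', if_pos]
  simpa using hn

/-- Integrals of `𝒫`-adic partial sums over sets saturated at rank `K` do not depend on the
rank `N ≥ K`. -/
theorem setIntegral_priceSum_mul_conj_of_le (hp : ∀ j i, 2 ≤ p j i) (b : (Fin d → ℕ) → ℂ)
    {n : Fin d → ℕ} {K N : ℕ} (hn : ∀ j, n j < mseq (p j) K) (hKN : K ≤ N)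
    {A : Set (Fin d → ℝ)} (hA : ∀ x y, cellIndex p K x = cellIndex p K y → x ∈ A → y ∈ A)
    (hAfin : volume A ≠ ⊤) :
    ∫ x in A, priceSum p b N x * (starRingEnd ℂ) (priceD p n x) =
      ∫ x in A, priceSum p b K x * (starRingEnd ℂ) (priceD p n x) := by
  have hAm : MeasurableSet A := measurableSet_of_saturated (measurable_cellIndex p K) hA
  induction N, hKN using Nat.le_induction with
  | base => rfl
  | succ N hKN ih =>
    rw [← ih]
    have hA' : ∀ x y, cellIndex p N x = cellIndex p N y → x ∈ A → y ∈ A := fun x y h =>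
      hA x y (cellIndex_eq_of_le hp hKN h)
    exact setIntegral_eq_of_fibers (measurable_cellIndex p N) hA'
      (integrableOn_priceSum_mul_conj hp b n (N + 1) hAfin)
      (integrableOn_priceSum_mul_conj hp b n N hAfin)
      fun a => setIntegral_priceSum_mul_conj_succ hp b
        (fun j => (hn j).trans_le (mseq_mono (hp j) hKN)) a

theorem trunc_norm_le {α : Type*} {f : α → ℂ} {lam : α → ℝ} {x : α} (h : 0 ≤ lam x) :
    ‖trunc f lam x‖ ≤ lam x := by
  unfold trunc
  split_ifs with h'
  · exact h'
  · simpa using h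

theorem aemeasurable_trunc {α : Type*} [MeasurableSpace α] {μ : Measure α} {f : α → ℂ}
    {lam : α → ℝ} (hf : AEMeasurable f μ) (hlam : AEMeasurable lam μ) :
    AEMeasurable (trunc f lam) μ := by
  refine ⟨trunc (hf.mk f) (hlam.mk lam), ?_, ?_⟩
  · exact Measurable.ite (measurableSet_le hf.measurable_mk.norm hlam.measurable_mk)
      hf.measurable_mk measurable_const
  · filter_upwards [hf.ae_eq_mk, hlam.ae_eq_mk] with x hx hx'
    simp only [trunc, hx, hx']

/-- The stopping estimate on a single `𝒫`-adic parallelepiped. -/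
theorem cell_estimate (hp : ∀ j i, 2 ≤ p j i) {M : ℕ} (hM : ∀ j i, p j i ≤ M)
    {b : (Fin d → ℕ) → ℂ} {f : (Fin d → ℝ) → ℂ}
    (hconv : ∀ᵐ x ∂(volume.restrict (Set.Icc (0 : Fin d → ℝ) 1)),
      Tendsto (fun N => priceSum p b N x) atTop (𝓝 (f x)))
    {h : (Fin d → ℝ) → ℝ} {n : Fin d → ℕ} {K : ℕ} (hn : ∀ j, n j < mseq (p j) K)
    {E : Set (Fin d → ℝ)} (hE : MeasurableSet E)
    (hEsup : {x ∈ Set.Icc (0 : Fin d → ℝ) 1 | ∃ N, h x < ‖priceSum p b N x‖} ⊆ E)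
    {k : ℕ} {a : Fin d → ℤ} (hcell : cell p k a ⊆ Set.Icc 0 1)
    {lam : ℝ} (h0 : ∀ x ∈ cell p k a, 0 ≤ h x) (hlam : ∀ x ∈ cell p k a, h x ≤ lam)
    (hlam0 : 0 ≤ lam)
    (hF : IntegrableOn (trunc (fun y => f y * (starRingEnd ℂ) (priceD p n y)) h)
      (Set.Icc 0 1))
    (hstart : ((M : ℝ) + 1) ^ d * (((M : ℝ) + 1) ^ d) ^ K *
        volume.real (E ∩ cellIndex p k ⁻¹' {a}) < volume.real (cellIndex p k ⁻¹' {a})) :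
    ‖(∫ x in cellIndex p k ⁻¹' {a}, priceSum p b (k + K) x * (starRingEnd ℂ) (priceD p n x)) -
      ∫ x in cellIndex p k ⁻¹' {a},
        trunc (fun y => f y * (starRingEnd ℂ) (priceD p n y)) h x‖ ≤
      4 * ((M : ℝ) + 1) ^ d * lam * volume.real (E ∩ cellIndex p k ⁻¹' {a}) := by
  have hQcell := cellIndex_preimage_subset_cell (p := p) hp k a
  have hQfin := volume_cellIndex_preimage_ne_top (p := p) hp k a
  have hR : (1 : ℝ) ≤ ((M : ℝ) + 1) ^ d := one_le_pow₀ (by simp)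
  have hRpos : (0 : ℝ) < (((M : ℝ) + 1) ^ d) ^ K := by positivity
  refine stopping_estimate (c := fun N => cellIndex p (k + K + N))
    (T := fun N x => priceSum p b (k + K + N) x * (starRingEnd ℂ) (priceD p n x))
    (fun N => measurable_cellIndex p _)
    (fun N x y hxy => cellIndex_eq_of_le hp (Nat.le_succ _) hxy) ?_ ?_ hR
    (fun N x => volume_cell_regular hp hM _ _ _) hE hQfin ?_
    (fun N => integrableOn_priceSum_mul_conj hp b n _ hQfin) ?_ hlam0 ?_
    (hF.mono_set (hQcell.trans hcell)) ?_ ?_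
  · intro N x y hxy
    show priceSum p b _ x * _ = priceSum p b _ y * _
    rw [priceSum_congr hp b hxy, priceD_congr hp (fun j => (hn j).trans_le
      (mseq_mono (hp j) (by omega))) hxy]
  · exact fun N a => setIntegral_priceSum_mul_conj_succ hp b (fun j => (hn j).trans_le
      (mseq_mono (hp j) (by omega))) a
  · intro x y hxy hx
    exact (cellIndex_eq_of_le hp (by omega) hxy).symm.trans hx
  · intro x hx
    have h1 := volume_cell_regular_add hp hM k K a (cellIndex p (k + K) x)
    have h2 : volume.real (E ∩ cellIndex p (k + K) ⁻¹' {cellIndex p (k + K) x}) ≤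
        volume.real (E ∩ cellIndex p k ⁻¹' {a}) := by
      refine measureReal_mono (Set.inter_subset_inter_right _ ?_)
        (measure_ne_top_of_subset Set.inter_subset_right hQfin)
      exact fun y hy => (cellIndex_eq_of_le hp (by omega) hy).trans hx
    have h3 := hstart.trans_le h1
    rw [mul_comm (((M : ℝ) + 1) ^ d), mul_assoc] at h3
    exact (mul_le_mul_of_nonneg_left h2 (by positivity)).trans_lt
      (lt_of_mul_lt_mul_left h3 hRpos.le)
  · intro x hx hxE N
    rw [norm_mul, RCLike.norm_conj, norm_priceD, mul_one]
    refine le_trans ?_ (hlam x (hQcell hx))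
    by_contra! hlt
    exact hxE (hEsup ⟨hcell (hQcell hx), _, hlt⟩)
  · exact fun x hx => (trunc_norm_le (h0 x (hQcell hx))).trans (hlam x (hQcell hx))
  · have hconv' := (ae_restrict_iff' measurableSet_Icc).1 hconv
    filter_upwards [hconv'] with x hx hxQ hxE
    have hxI := hcell (hQcell hxQ)
    have hb : ∀ N, ‖priceSum p b N x‖ ≤ h x := by
      intro N
      by_contra! hlt
      exact hxE (hEsup ⟨hxI, N, hlt⟩)
    have hfx : ‖f x‖ ≤ h x := le_of_tendsto' (hx hxI).norm hb
    rw [trunc, if_pos (by rwa [norm_mul, RCLike.norm_conj, norm_priceD, mul_one])]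
    refine Tendsto.mul_const _ ((hx hxI).comp ?_)
    exact tendsto_atTop_mono (fun N => Nat.le_add_left N _) tendsto_id

theorem aedisjoint_of_disjoint_interior {s t : Set (Fin d → ℝ)} (hs : Convex ℝ s)
    (ht : Convex ℝ t) (hst : Disjoint (interior s) (interior t)) : AEDisjoint volume s t := by
  have key : ∀ {u : Set (Fin d → ℝ)}, Convex ℝ u → u ≤ᵐ[volume] interior u := by
    intro u hu
    refine ae_le_set.2 (measure_mono_null ?_ (hu.addHaar_frontier volume))
    exact Set.sdiff_subset_sdiff_left subset_closure
  exact hst.aedisjoint.mono_ae (key hs) (key ht)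

theorem convex_cell (k : ℕ) (a : Fin d → ℤ) : Convex ℝ (cell p k a) :=
  convex_pi fun _ _ => convex_Icc _ _

/-- Estimate of the difference between a coefficient and the truncated integral, for a single
truncating function. -/
theorem norm_coefficient_sub_integral_trunc_le (hp : ∀ j i, 2 ≤ p j i) {M : ℕ}
    (hM : ∀ j i, p j i ≤ M) {b : (Fin d → ℕ) → ℂ} {f : (Fin d → ℝ) → ℂ}
    (hconv : ∀ᵐ x ∂(volume.restrict (Set.Icc (0 : Fin d → ℝ) 1)),
      Tendsto (fun N => priceSum p b N x) atTop (𝓝 (f x)))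
    {h : (Fin d → ℝ) → ℝ} (h0 : ∀ x ∈ Set.Icc (0 : Fin d → ℝ) 1, 0 ≤ h x)
    {n : Fin d → ℕ} {K : ℕ} (hn : ∀ j, n j < mseq (p j) K)
    {C ε : ℝ} (hC : 0 < C) (hε : 0 < ε) {s : ℕ} {J : Fin s → Set (Fin d → ℝ)}
    (hJ : ∀ i, J i ∈ Lambda p)
    (hJd : ∀ i j, i ≠ j → Disjoint (interior (J i)) (interior (J j)))
    (hJU : (⋃ i, J i) = Set.Icc 0 1)
    (hJC : ∀ i, ∀ x ∈ J i, ∀ y ∈ J i, h x ≤ C * h y)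
    (hJε : ∀ i, ε ≤ ∫ x in J i, h x)
    (hδ : ((M : ℝ) + 1) ^ d * (((M : ℝ) + 1) ^ d) ^ K * (C * C *
      ∫ x in {x ∈ Set.Icc (0 : Fin d → ℝ) 1 | ∃ N, h x < ‖priceSum p b N x‖}, h x) < ε) :
    ‖b n - ∫ x in Set.Icc (0 : Fin d → ℝ) 1,
        trunc (fun y => f y * (starRingEnd ℂ) (priceD p n y)) h x‖ ≤
      4 * ((M : ℝ) + 1) ^ d * (C * C *
        ∫ x in {x ∈ Set.Icc (0 : Fin d → ℝ) 1 | ∃ N, h x < ‖priceSum p b N x‖}, h x) := by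
  choose k a hJka using hJ
  set Q : Fin s → Set (Fin d → ℝ) := fun i => cellIndex p (k i) ⁻¹' {a i} with hQ
  have hQJ : ∀ i, Q i =ᵐ[volume] J i := fun i => by
    rw [hJka i]
    exact cellIndex_preimage_ae_eq_cell hp _ _
  have hQsub : ∀ i, Q i ⊆ J i := fun i => by
    rw [hJka i]
    exact cellIndex_preimage_subset_cell hp _ _
  have hJsub : ∀ i, J i ⊆ Set.Icc 0 1 := fun i => hJU ▸ Set.subset_iUnion J i
  have hQm : ∀ i, MeasurableSet (Q i) := fun i =>
    measurable_cellIndex p (k i) (measurableSet_singleton (a i))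
  have hQfin : ∀ i, volume (Q i) ≠ ⊤ := fun i => volume_cellIndex_preimage_ne_top hp _ _
  have hsplit : ∀ {G : Type} [NormedAddCommGroup G] [NormedSpace ℝ G] {u : (Fin d → ℝ) → G},
      IntegrableOn u (Set.Icc 0 1) → ∫ x in Set.Icc 0 1, u x = ∑ i, ∫ x in Q i, u x := by
    intro G _ _ u hu
    rw [← hJU] at hu ⊢
    rw [integral_iUnion_ae (fun i => (hQm i).nullMeasurableSet.congr (hQJ i)) ?_ hu, tsum_fintype]
    · exact Finset.sum_congr rfl fun i _ => setIntegral_congr_set (hQJ i).symm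
    · intro i j hij
      refine aedisjoint_of_disjoint_interior ?_ ?_ (hJd i j hij)
      · rw [hJka i]; exact convex_cell _ _
      · rw [hJka j]; exact convex_cell _ _
  have hJint : ∀ i, IntegrableOn h (J i) := by
    intro i
    by_contra hni
    have := hJε i
    rw [integral_undef hni] at this
    linarith
  have hint : IntegrableOn h (Set.Icc 0 1) := by
    rw [← hJU]
    exact integrableOn_finite_iUnion.2 hJint
  have hJne : ∀ i, (J i).Nonempty := by
    intro i
    rw [Set.nonempty_iff_ne_empty]
    intro he
    have := hJε i
    rw [he, setIntegral_empty] at this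
    linarith
  choose y hy using hJne
  set E₀ := {x ∈ Set.Icc (0 : Fin d → ℝ) 1 | ∃ N, h x < ‖priceSum p b N x‖} with hE₀
  have hE₀m : NullMeasurableSet E₀ volume := by
    have h1 : NullMeasurableSet (⋃ N, {x | h x < ‖priceSum p b N x‖})
        (volume.restrict (Set.Icc 0 1)) :=
      NullMeasurableSet.iUnion fun N => nullMeasurableSet_lt
        hint.aestronglyMeasurable.aemeasurable (measurable_priceSum hp b N).norm.aemeasurable
    rw [nullMeasurableSet_restrict measurableSet_Icc.nullMeasurableSet] at h1
    convert h1 using 1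
    ext x
    simp [hE₀, and_comm]
  obtain ⟨E, hEsup, hEm, hEae⟩ := hE₀m.exists_measurable_superset_ae_eq
  have hF : IntegrableOn (trunc (fun y => f y * (starRingEnd ℂ) (priceD p n y)) h)
      (Set.Icc 0 1) := by
    have hfm : AEMeasurable f (volume.restrict (Set.Icc 0 1)) :=
      aemeasurable_of_tendsto_metrizable_ae atTop
        (fun N => (measurable_priceSum hp b N).aemeasurable) hconv
    refine Integrable.mono' hint (aemeasurable_trunc (hfm.mul
      (Complex.continuous_conj.measurable.comp (measurable_priceD hp n)).aemeasurable)
      hint.aestronglyMeasurable.aemeasurable).aestronglyMeasurable ?_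
    exact (ae_restrict_iff' measurableSet_Icc).2 (ae_of_all _ fun x hx => trunc_norm_le (h0 x hx))
  set δ := ∫ x in E₀, h x with hδdef
  have hδsum : δ = ∑ i, ∫ x in Q i ∩ E, h x := by
    have := hsplit (hint.indicator hEm)
    simp only [setIntegral_indicator hEm] at this
    rw [← this]
    refine setIntegral_congr_set ?_
    have h1 : E₀ = Set.Icc 0 1 ∩ E₀ := (Set.inter_eq_right.2 fun x hx => hx.1).symm
    rw [h1]
    exact (ae_eq_refl _).inter hEae.symm
  have hv0 : ∀ i, 0 ≤ ∫ x in Q i ∩ E, h x := fun i =>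
    setIntegral_nonneg ((hQm i).inter hEm) fun x hx => h0 x (hJsub i (hQsub i hx.1))
  have hvδ : ∀ i, ∫ x in Q i ∩ E, h x ≤ δ := fun i => by
    rw [hδsum]
    exact Finset.single_le_sum (f := fun i => ∫ x in Q i ∩ E, h x) (fun i _ => hv0 i)
      (Finset.mem_univ i)
  set lam : Fin s → ℝ := fun i => C * h (y i) with hlam
  have hlam0 : ∀ i, 0 ≤ lam i := fun i => mul_nonneg hC.le (h0 _ (hJsub i (hy i)))
  have hle : ∀ i, ∀ x ∈ J i, h x ≤ lam i := fun i x hx => hJC i x hx _ (hy i)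
  have hge : ∀ i, ∀ x ∈ J i, lam i ≤ C * C * h x := fun i x hx => by
    rw [mul_assoc]
    exact mul_le_mul_of_nonneg_left (hJC i _ (hy i) x hx) hC.le
  have hlamE : ∀ i, lam i * volume.real (E ∩ Q i) ≤ C * C * ∫ x in Q i ∩ E, h x := by
    intro i
    rw [← integral_const_mul, mul_comm, Set.inter_comm, ← smul_eq_mul, ← setIntegral_const]
    refine setIntegral_mono_on (integrableOn_const
      (measure_ne_top_of_subset Set.inter_subset_left (hQfin i)))
      (Integrable.const_mul (hint.mono_set ?_) _) ((hQm i).inter hEm)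
      fun x hx => hge i x (hQsub i hx.1)
    exact Set.inter_subset_left.trans ((hQsub i).trans (hJsub i))
  have hlamQ : ∀ i, ε ≤ lam i * volume.real (Q i) := by
    intro i
    refine (hJε i).trans ?_
    rw [setIntegral_congr_set (hQJ i).symm, mul_comm, ← smul_eq_mul, ← setIntegral_const]
    exact setIntegral_mono_on ((hJint i).mono_set (hQsub i)) (integrableOn_const (hQfin i))
      (hQm i) fun x hx => hle i x (hQsub i hx)
  have hcells : ∀ i, ‖(∫ x in Q i, priceSum p b (k i + K) x * (starRingEnd ℂ) (priceD p n x)) -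
      ∫ x in Q i, trunc (fun y => f y * (starRingEnd ℂ) (priceD p n y)) h x‖ ≤
      4 * ((M : ℝ) + 1) ^ d * lam i * volume.real (E ∩ Q i) := by
    intro i
    refine cell_estimate hp hM hconv hn hEm hEsup (hJka i ▸ hJsub i)
      (hJka i ▸ fun x hx => h0 x (hJsub i hx)) (hJka i ▸ hle i) (hlam0 i) hF ?_
    refine lt_of_mul_lt_mul_left ?_ (hlam0 i)
    refine lt_of_lt_of_le (lt_of_le_of_lt ?_ hδ) (hlamQ i)
    rw [mul_left_comm]
    refine mul_le_mul_of_nonneg_left ((hlamE i).trans ?_) (by positivity)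
    exact mul_le_mul_of_nonneg_left (hvδ i) (by positivity)
  have hbn : b n =
      ∑ i, ∫ x in Q i, priceSum p b (k i + K) x * (starRingEnd ℂ) (priceD p n x) := by
    set L := ∑ i, (k i + K) + K with hL
    rw [← setIntegral_priceSum_mul_conj hp b (N := L)
      (fun j => (hn j).trans_le (mseq_mono (hp j) (by omega))),
      hsplit (integrableOn_priceSum_mul_conj hp b n L measure_Icc_lt_top.ne)]
    refine Finset.sum_congr rfl fun i _ => ?_
    have hiL : k i + K ≤ L := (Finset.single_le_sum (f := fun i => k i + K)
      (fun i _ => Nat.zero_le _) (Finset.mem_univ i)).trans (Nat.le_add_right _ _)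
    exact setIntegral_priceSum_mul_conj_of_le hp b
      (fun j => (hn j).trans_le (mseq_mono (hp j) (by omega))) hiL
      (fun x y hxy hx => (cellIndex_eq_of_le hp (by omega) hxy).symm.trans hx) (hQfin i)
  rw [hbn, hsplit hF, ← Finset.sum_sub_distrib]
  refine (norm_sum_le _ _).trans ((Finset.sum_le_sum fun i _ => hcells i).trans ?_)
  rw [hδsum, Finset.mul_sum, Finset.mul_sum]
  refine Finset.sum_le_sum fun i _ => ?_
  rw [mul_assoc (4 * ((M : ℝ) + 1) ^ d)]
  exact mul_le_mul_of_nonneg_left (hlamE i) (by positivity)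

end Multi

/-- **Theorem (recovery of the coefficients of a multiple Price series).**
Let the `𝒫`-adic partial sums `S_N = ∑_{n̄ < Ñ} b_{n̄} ψ^𝒫_{n̄}` converge a.e. on
`[0,1]ᵈ` to `f`, with `sup_{i,j} pʲᵢ ≤ M < ∞`.  If `{h m}` satisfies (h1)–(h3) on
`[0,1]ᵈ` and `∫_{{Ψ* > h m}} h m → 0`, where `Ψ*(x) = sup_N |S_N(x)|`, then for every
`n̄ ∈ ℤ₊ᵈ`, `b_{n̄} = lim_m ∫_{[0,1]ᵈ} [f · conj (ψ^𝒫_{n̄})]_{h m}`. -/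
theorem coefficient_recovery_price
    (d : ℕ) (p : Fin d → ℕ → ℕ) (hp : ∀ j i, 2 ≤ p j i)
    (M : ℕ) (hM : ∀ j i, p j i ≤ M)
    (b : (Fin d → ℕ) → ℂ) (f : (Fin d → ℝ) → ℂ)
    (hconv : ∀ᵐ x ∂(volume.restrict (Set.Icc (0 : Fin d → ℝ) 1)),
      Tendsto (fun N => priceSum p b N x) atTop (𝓝 (f x)))
    (h : ℕ → (Fin d → ℝ) → ℝ) (hh : HConds p (Set.Icc (0 : Fin d → ℝ) 1) h)
    (hsmall : Tendsto (fun m =>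
        ∫ x in {x ∈ Set.Icc (0 : Fin d → ℝ) 1 | ∃ N, h m x < ‖priceSum p b N x‖},
          h m x)
      atTop (𝓝 0)) :
    ∀ n : Fin d → ℕ,
      Tendsto (fun m => ∫ x in Set.Icc (0 : Fin d → ℝ) 1,
          trunc (fun y => f y * (starRingEnd ℂ) (priceD p n y)) (h m) x)
        atTop (𝓝 (b n)) := by
  intro n
  obtain ⟨hh1, C, hC, ε, hε, hJ⟩ := hh
  obtain ⟨K, hK⟩ : ∃ K, ∀ j, n j < mseq (p j) K :=
    ⟨∑ j, n j, fun j => (lt_mseq (hp j) (n j)).trans_le (mseq_mono (hp j)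
      (Finset.single_le_sum (fun i _ => Nat.zero_le (n i)) (Finset.mem_univ j)))⟩
  have hs1 := (hsmall.const_mul (C * C)).const_mul (((M : ℝ) + 1) ^ d * (((M : ℝ) + 1) ^ d) ^ K)
  have hs2 := (hsmall.const_mul (C * C)).const_mul (4 * ((M : ℝ) + 1) ^ d)
  simp only [mul_zero] at hs1 hs2
  rw [tendsto_iff_norm_sub_tendsto_zero]
  refine squeeze_zero' (Eventually.of_forall fun m => norm_nonneg _) ?_ hs2
  filter_upwards [hs1.eventually_lt_const hε] with m hm
  obtain ⟨s, J, hJ1, hJ2, hJ3, hJ4, hJ5⟩ := hJ m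
  rw [norm_sub_rev]
  exact norm_coefficient_sub_integral_trunc_le hp hM hconv (fun x hx => (hh1 x hx).1 m) hK hC hε
    hJ1 hJ2 hJ3 hJ4 hJ5 hm
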